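/- Let f : ℝ^n → ℝ^n be twice continuously differentiable and let x : ℝ → ℝ^n solve x' = f(x) with x(0) = x0. Define the Lie–Trotter D-splitting step v1(h) = x0 + h·f(x0) and u1(h) = x0 + h·f(v1(h)). Then, as h → 0, x(h) − v1(h) = (h²/2)·Df(x0)[f(x0)] + o(h²) and x(h) − u1(h) = −(h²/2)·Df(x0)[f(x0)] + o(h²); in particular the leading (second-order) error terms of u1 and v1 are opposite and cancel in the average. -/

import Mathlib

open Asymptotics

/-- If the derivative of `g` is `o(t)` at `0`, then `g` differs from `g 0` by `o(t²)`. -/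
theorem isLittleO_sq_of_hasDerivAt_isLittleO {E : Type*} [NormedAddCommGroup E] [NormedSpace ℝ E]
    {g g' : ℝ → E} (hg : ∀ t, HasDerivAt g (g' t) t)
    (hg' : g' =o[nhds 0] (fun t : ℝ => t)) :
    (fun t : ℝ => g t - g 0) =o[nhds 0] (fun t : ℝ => t ^ 2) := by
  rw [isLittleO_iff] at hg' ⊢
  intro c hc
  obtain ⟨δ, hδ, hball⟩ := Metric.eventually_nhds_iff.mp (hg' hc)
  refine Metric.eventually_nhds_iff.mpr ⟨δ, hδ, fun t ht => ?_⟩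
  rw [Real.dist_eq, sub_zero] at ht
  have hbound : ∀ s ∈ Metric.closedBall (0 : ℝ) |t|, ‖g' s‖ ≤ c * |t| := by
    intro s hs
    rw [Metric.mem_closedBall] at hs
    refine (hball (hs.trans_lt ht)).trans ?_
    rw [dist_zero_right] at hs
    gcongr
  have h := (convex_closedBall (0 : ℝ) |t|).norm_image_sub_le_of_norm_hasDerivWithin_le
    (fun s _ => (hg s).hasDerivWithinAt) hbound
    (Metric.mem_closedBall_self (abs_nonneg t)) (y := t) (by simp)
  refine h.trans_eq ?_
  rw [sub_zero, norm_pow, Real.norm_eq_abs]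
  ring

/-- Leading error expansion of the Lie–Trotter D-splitting step: for the ODE `x' = f(x)`,
`x(0) = x0`, with `v1(h) = x0 + h f(x0)` and `u1(h) = x0 + h f(v1(h))`, one has
`x(h) - v1(h) = (h²/2) Df(x0)[f(x0)] + o(h²)` and
`x(h) - u1(h) = -(h²/2) Df(x0)[f(x0)] + o(h²)` as `h → 0`. -/
theorem dsplit_lieTrotter_leading_errors_opposite {n : ℕ}
    (f : (Fin n → ℝ) → (Fin n → ℝ)) (hf : ContDiff ℝ 2 f)
    (x0 : Fin n → ℝ) (x : ℝ → (Fin n → ℝ))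
    (hx : ∀ t, HasDerivAt x (f (x t)) t) (hx0 : x 0 = x0)
    (v1 u1 : ℝ → (Fin n → ℝ))
    (hv1 : ∀ h : ℝ, v1 h = x0 + h • f x0)
    (hu1 : ∀ h : ℝ, u1 h = x0 + h • f (v1 h)) :
    (fun h : ℝ => x h - v1 h - (h ^ 2 / 2) • (fderiv ℝ f x0) (f x0))
      =o[nhds 0] (fun h : ℝ => h ^ 2) ∧
    (fun h : ℝ => x h - u1 h + (h ^ 2 / 2) • (fderiv ℝ f x0) (f x0))
      =o[nhds 0] (fun h : ℝ => h ^ 2) := by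
  have hfd : HasFDerivAt f (fderiv ℝ f x0) x0 :=
    ((hf.differentiable (by norm_num)) x0).hasFDerivAt
  set c := (fderiv ℝ f x0) (f x0)
  have hfx : HasDerivAt (fun t => f (x t)) c 0 := by
    have h := hx 0
    rw [hx0] at h
    exact HasFDerivAt.comp_hasDerivAt (0 : ℝ) (by rwa [hx0]) h
  have hv_deriv : ∀ t : ℝ, HasDerivAt v1 (f x0) t := by
    intro t
    rw [funext hv1]
    simpa using ((hasDerivAt_id t).smul_const (f x0)).const_add x0
  have hv0 : v1 0 = x0 := by simp [hv1]
  have hfv : HasDerivAt (fun t => f (v1 t)) c 0 :=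
    HasFDerivAt.comp_hasDerivAt (0 : ℝ) (by rwa [hv0]) (hv_deriv 0)
  have hv_error : (fun h : ℝ => x h - v1 h - (h ^ 2 / 2) • c)
      =o[nhds 0] (fun h : ℝ => h ^ 2) := by
    have hderiv : ∀ t : ℝ, HasDerivAt (fun h : ℝ => x h - v1 h - (h ^ 2 / 2) • c)
        (f (x t) - f x0 - t • c) t := by
      intro t
      have hsq : HasDerivAt (fun h : ℝ => h ^ 2 / 2) t t := by
        simpa using (hasDerivAt_pow 2 t).div_const 2
      exact ((hx t).sub (hv_deriv t)).sub (hsq.smul_const c)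
    have hsmall : (fun t : ℝ => f (x t) - f x0 - t • c) =o[nhds 0] (fun t : ℝ => t) := by
      simpa [hx0] using hfx.isLittleO
    simpa [hx0, hv0] using isLittleO_sq_of_hasDerivAt_isLittleO hderiv hsmall
  refine ⟨hv_error, ?_⟩
  have hsmall : (fun t : ℝ => f (v1 t) - f x0 - t • c) =o[nhds 0] (fun t : ℝ => t) := by
    simpa [hv0] using hfv.isLittleO
  have hmul : (fun t : ℝ => t • (f (v1 t) - f x0 - t • c)) =o[nhds 0] (fun t : ℝ => t ^ 2) := by
    simpa [pow_two] using (isBigO_refl (fun t : ℝ => t) (nhds 0)).smul_isLittleO hsmall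
  refine (hv_error.sub hmul).congr_left fun h => ?_
  rw [hu1 h, hv1 h]
  module
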